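/- Let D = (V, E, w) be a vertex-weighted rooted forest (a disjoint union of rooted trees, i.e. oriented trees in which all edges are oriented away from the root) such that w(x) ≥ 2 for every vertex x whose degree in the underlying graph is not 1. Then for every integer t ≥ 1, the projective dimension of the S-module I(D)^t equals |E| − 1, where |E| is the number of edges of D. -/

import Mathlib

open MvPolynomial

universe u v

/-- `HasProjDimLE R n M` : the `R`-module `M` admits a projective resolution of length `≤ n`. -/
def HasProjDimLE (R : Type u) [Ring R] :
    ℕ → ∀ (M : Type v) [AddCommGroup M] [Module R M], Prop
  | 0, M, _, _ => Module.Projective R M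
  | n + 1, M, _, _ =>
      ∃ (P : Type v) (_ : AddCommGroup P) (_ : Module R P) (f : P →ₗ[R] M),
        Module.Projective R P ∧ Function.Surjective f ∧
          HasProjDimLE R n (LinearMap.ker f)

/-- The projective dimension of an `R`-module `M`: the minimal length of a projective
resolution of `M` (`⊤` if there is no finite projective resolution). -/
noncomputable def projDim (R : Type u) [Ring R] (M : Type v) [AddCommGroup M]
    [Module R M] : ℕ∞ :=
  sInf {n : ℕ∞ | ∃ m : ℕ, (m : ℕ∞) = n ∧ HasProjDimLE R m M}

/-- The edge ideal of a vertex-weighted oriented graph with edge set `E` and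
weight function `w`. -/
noncomputable def edgeIdeal (k : Type*) [Field k] {V : Type*} (E : Finset (V × V))
    (w : V → ℕ) : Ideal (MvPolynomial V k) :=
  Ideal.span ((fun e : V × V => X e.1 * X e.2 ^ w e.2) '' (E : Set (V × V)))


open CategoryTheory Abelian

section Homological

variable {R : Type u} [CommRing R]

theorem hasProjDimLE_iff_hasProjectiveDimensionLT (n : ℕ) (M : Type u) [AddCommGroup M]
    [Module R M] :
    HasProjDimLE R n M ↔ HasProjectiveDimensionLT (ModuleCat.of R M) (n + 1) := by
  induction n generalizing M with
  | zero =>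
    rw [zero_add, ← projective_iff_hasProjectiveDimensionLT_one, ← IsProjective.iff_projective]
    rfl
  | succ n ih =>
    constructor
    · rintro ⟨P, _, _, f, hP, hf, h⟩
      have hS := LinearMap.shortExact_shortComplexKer hf
      exact (hS.hasProjectiveDimensionLT_X₃_iff n
        ((IsProjective.iff_projective (R := R) P).1 hP)).2 ((ih _).1 h)
    · intro h
      let f : (M →₀ R) →ₗ[R] M := Finsupp.linearCombination R id
      have hf : Function.Surjective f := Finsupp.linearCombination_id_surjective R M
      have hP : Module.Projective R (M →₀ R) := inferInstance
      have hS := LinearMap.shortExact_shortComplexKer hf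
      exact ⟨M →₀ R, inferInstance, inferInstance, f, hP, hf, (ih _).2
        ((hS.hasProjectiveDimensionLT_X₃_iff n
          ((IsProjective.iff_projective (R := R) (M →₀ R)).1 hP)).1 h)⟩

theorem hasProjectiveDimensionLT_quotient_iff (I : Ideal R) (n : ℕ) :
    HasProjectiveDimensionLT (ModuleCat.of R (R ⧸ I)) (n + 2) ↔
      HasProjectiveDimensionLT (ModuleCat.of R I) (n + 1) := by
  let S : ShortComplex (ModuleCat.{u} R) :=
    ⟨ModuleCat.ofHom I.subtype, ModuleCat.ofHom I.mkQ,
      ModuleCat.hom_ext (LinearMap.exact_subtype_mkQ I).linearMap_comp_eq_zero⟩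
  have hS : S.ShortExact :=
    { exact := (ShortComplex.ShortExact.moduleCat_exact_iff_function_exact _).mpr
        (LinearMap.exact_subtype_mkQ I)
      mono_f := (ModuleCat.mono_iff_injective _).mpr I.injective_subtype
      epi_g := (ModuleCat.epi_iff_surjective _).mpr I.mkQ_surjective }
  exact hS.hasProjectiveDimensionLT_X₃_iff n
    ((IsProjective.iff_projective (R := R) R).1 inferInstance)

theorem exists_shortExact_quotient {I K : Ideal R} {x : R} (hK : ∀ g, x * g ∈ I ↔ g ∈ K) :
    ∃ S : ShortComplex (ModuleCat.{u} R), S.ShortExact ∧ S.X₁ = ModuleCat.of R (R ⧸ K) ∧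
      S.X₂ = ModuleCat.of R (R ⧸ I) ∧ S.X₃ = ModuleCat.of R (R ⧸ (I ⊔ Ideal.span {x})) := by
  let f : (R ⧸ K) →ₗ[R] (R ⧸ I) :=
    Submodule.mapQ K I (LinearMap.lsmul R R x) (show K ≤ Submodule.comap _ I from
      fun g hg ↦ Submodule.mem_comap.2 ((hK g).2 hg))
  let g : (R ⧸ I) →ₗ[R] (R ⧸ (I ⊔ Ideal.span {x})) :=
    Submodule.mapQ I _ LinearMap.id (show I ≤ Submodule.comap _ _ from
      fun _ h ↦ Submodule.mem_comap.2 (Ideal.mem_sup_left h))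
  have hex : Function.Exact f g := by
    intro a
    obtain ⟨a, rfl⟩ := Submodule.mkQ_surjective I a
    simp only [f, g, Submodule.mkQ_apply, Submodule.mapQ_apply, LinearMap.id_apply,
      Submodule.Quotient.mk_eq_zero, Set.mem_range]
    constructor
    · intro h
      obtain ⟨i, hi, y, hy, rfl⟩ := Submodule.mem_sup.1 h
      obtain ⟨c, rfl⟩ := Ideal.mem_span_singleton.1 hy
      refine ⟨Submodule.Quotient.mk c, ?_⟩
      rw [Submodule.mapQ_apply, Submodule.Quotient.eq]
      simpa using hi
    · rintro ⟨y, hy⟩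
      obtain ⟨c, rfl⟩ := Submodule.mkQ_surjective K y
      rw [Submodule.mkQ_apply, Submodule.mapQ_apply, Submodule.Quotient.eq] at hy
      have : a = -(x * c - a) + x * c := by ring
      rw [this]
      exact add_mem (Ideal.mem_sup_left (neg_mem hy))
        (Ideal.mem_sup_right (Ideal.mem_span_singleton.2 ⟨c, rfl⟩))
  refine ⟨⟨ModuleCat.ofHom f, ModuleCat.ofHom g,
    ModuleCat.hom_ext hex.linearMap_comp_eq_zero⟩, @ShortComplex.ShortExact.mk _ _ _ _
      ((ShortComplex.ShortExact.moduleCat_exact_iff_function_exact _).mpr hex)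
      ((ModuleCat.mono_iff_injective _).mpr ?_) ((ModuleCat.epi_iff_surjective _).mpr ?_),
    rfl, rfl, rfl⟩
  · refine ((injective_iff_map_eq_zero f).2 fun a ha ↦ ?_)
    obtain ⟨a, rfl⟩ := Submodule.mkQ_surjective K a
    simp only [f, Submodule.mkQ_apply, Submodule.mapQ_apply, Submodule.Quotient.mk_eq_zero] at ha ⊢
    exact (hK a).1 ha
  · intro a
    obtain ⟨a, rfl⟩ := Submodule.mkQ_surjective _ a
    exact ⟨Submodule.Quotient.mk a, by simp [g]⟩

theorem hasProjectiveDimensionLT_quotient_of_colon {I K : Ideal R} {x : R}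
    (hK : ∀ g, x * g ∈ I ↔ g ∈ K) {n : ℕ}
    (h₁ : HasProjectiveDimensionLT (ModuleCat.of R (R ⧸ K)) n)
    (h₂ : HasProjectiveDimensionLT (ModuleCat.of R (R ⧸ (I ⊔ Ideal.span {x}))) n) :
    HasProjectiveDimensionLT (ModuleCat.of R (R ⧸ I)) n := by
  obtain ⟨S, hS, e₁, e₂, e₃⟩ := exists_shortExact_quotient hK
  rw [← e₂]
  exact hS.hasProjectiveDimensionLT_X₂ n (e₁ ▸ h₁) (e₃ ▸ h₂)

theorem hasProjectiveDimensionLT_quotient_sup_span {I : Ideal R} {x : R}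
    (hI : ∀ g, x * g ∈ I → g ∈ I) {n : ℕ}
    (h : HasProjectiveDimensionLT (ModuleCat.of R (R ⧸ I)) n) :
    HasProjectiveDimensionLT (ModuleCat.of R (R ⧸ (I ⊔ Ideal.span {x}))) (n + 1) := by
  obtain ⟨S, hS, e₁, e₂, e₃⟩ :=
    exists_shortExact_quotient fun g ↦ ⟨hI g, I.mul_mem_left x⟩
  rw [← e₃]
  exact hS.hasProjectiveDimensionLT_X₃ n (e₁ ▸ h)
    (e₂ ▸ hasProjectiveDimensionLT_of_ge _ n (n + 1) n.le_succ)

open RingTheory.Sequence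

theorem subsingleton_ext_of_isWeaklyRegular (N : ModuleCat.{u} R) (rs : List R)
    (hN : ∀ r ∈ rs, r ∈ Module.annihilator R N) (M : ModuleCat.{u} R)
    (hM : IsWeaklyRegular M rs) (i : ℕ) (hi : i < rs.length) : Subsingleton (Ext N M i) := by
  induction rs generalizing M i with
  | nil => simp at hi
  | cons r rs ih =>
    rw [isWeaklyRegular_cons_iff] at hM
    have hS := hM.1.smulShortComplex_shortExact
    have hr : ∀ n (x : Ext N M n),
        x.comp (Ext.mk₀ (M.smulShortComplex r).f) (add_zero n) = 0 := by
      intro n x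
      have h0 : r • 𝟙 N = 0 := by
        simp [← ModuleCat.lsmul_eq_smul_id,
          Module.mem_annihilator_iff_lsmul_eq_zero.mp (hN r (by simp))]
      have : r • x = (Ext.mk₀ (r • 𝟙 N)).comp x (zero_add n) := by simp [Ext.mk₀_smul]
      rw [h0, Ext.mk₀_zero, Ext.zero_comp] at this
      have h : x.comp (Ext.mk₀ (r • 𝟙 M)) (add_zero n) = r • x := by simp [Ext.mk₀_smul]
      exact h.trans this
    refine subsingleton_of_forall_eq 0 fun x ↦ ?_
    cases i with
    | zero =>
      have := hS.mono_f
      have hinj := Ext.postcomp_mk₀_injective_of_mono N (M.smulShortComplex r).f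
      exact hinj ((hr 0 x).trans (map_zero _).symm)
    | succ i =>
      obtain ⟨y, rfl⟩ := Ext.covariant_sequence_exact₁ N hS x (hr _ x) rfl
      have := ih (fun s hs ↦ hN s (by simp [hs])) (ModuleCat.of R (QuotSMulTop r M)) hM.2 i
        (by simpa using hi)
      have hy : y = 0 := this.elim _ _
      rw [hy]
      exact Ext.zero_comp N i hS.extClass _ rfl

theorem subsingleton_ext_of_hasProjectiveDimensionLT (N : ModuleCat.{u} R) (rs : List R)
    (hN : ∀ r ∈ rs, r ∈ Module.annihilator R N) (hR : IsWeaklyRegular R rs)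
    (d : ℕ) (M : ModuleCat.{u} R) [hM : HasProjectiveDimensionLT M (d + 1)]
    (i : ℕ) (hi : i + d < rs.length) : Subsingleton (Ext N M i) := by
  have flat : ∀ P : ModuleCat.{u} R, Module.Flat R P → IsWeaklyRegular P rs := fun P _ ↦
    ((TensorProduct.rid R P).isWeaklyRegular_congr rs).1 (hR.isWeaklyRegular_lTensor)
  induction d generalizing M i with
  | zero =>
    rw [zero_add, ← projective_iff_hasProjectiveDimensionLT_one, ← IsProjective.iff_projective]
      at hM
    exact subsingleton_ext_of_isWeaklyRegular N rs hN M (flat M inferInstance) i hi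
  | succ d ih =>
    have hS := M.shortExact_projectiveShortComplex
    have hfree : Module.Free R M.projectiveShortComplex.X₂ := inferInstance
    have := (hS.hasProjectiveDimensionLT_X₃_iff d
      ((IsProjective.iff_projective (R := R) M.projectiveShortComplex.X₂).1 inferInstance)).1 hM
    refine subsingleton_of_forall_eq 0 fun x ↦ ?_
    have h1 := ih M.projectiveShortComplex.X₁ (i + 1) (by lia)
    have h2 := subsingleton_ext_of_isWeaklyRegular N rs hN M.projectiveShortComplex.X₂
      (flat _ inferInstance) i (by lia)
    obtain ⟨y, rfl⟩ := Ext.covariant_sequence_exact₃ N hS x rfl (h1.elim _ _)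
    have hy : y = 0 := h2.elim _ _
    rw [hy, Ext.zero_comp]

theorem mem_of_hasProjectiveDimensionLT_quotient {rs : List R} (hR : IsWeaklyRegular R rs)
    {I : Ideal R} {d : ℕ} (hd : d < rs.length)
    (hI : HasProjectiveDimensionLT (ModuleCat.of R (R ⧸ I)) (d + 1))
    {u : R} (hu : ∀ r ∈ rs, r * u ∈ I) : u ∈ I := by
  let N := ModuleCat.of R (R ⧸ Ideal.ofList rs)
  have hN : ∀ r ∈ rs, r ∈ Module.annihilator R N := fun r hr ↦ by
    change r ∈ Module.annihilator R (R ⧸ Ideal.ofList rs)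
    rw [Ideal.annihilator_quotient]
    exact Ideal.subset_span hr
  have hsub := subsingleton_ext_of_hasProjectiveDimensionLT N rs hN hR d
    (ModuleCat.of R (R ⧸ I)) 0 (by lia)
  let f : (R ⧸ Ideal.ofList rs) →ₗ[R] (R ⧸ I) :=
    Submodule.mapQ _ I (LinearMap.lsmul R R u) (show _ ≤ Submodule.comap _ I from
      Ideal.span_le.2 fun r hr ↦ Submodule.mem_comap.2 (by simpa [mul_comm] using hu r hr))
  have hf : ModuleCat.ofHom f = (0 : N ⟶ ModuleCat.of R (R ⧸ I)) :=
    (Ext.mk₀_bijective _ _).1 (hsub.elim _ _)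
  have := congrArg (fun g ↦ g.hom (Submodule.Quotient.mk 1)) hf
  have h1 : f (Submodule.Quotient.mk 1) = 0 := this
  rw [Submodule.mapQ_apply, Submodule.Quotient.mk_eq_zero] at h1
  simpa using h1

end Homological

section Ideals

variable {R : Type u} [CommRing R]

theorem Ideal.sup_pow_succ (A B : Ideal R) (t : ℕ) :
    (A ⊔ B) ^ (t + 1) = A ^ (t + 1) ⊔ B * (A ⊔ B) ^ t := by
  induction t with
  | zero => simp
  | succ t ih =>
    apply le_antisymm
    · rw [pow_succ' (A ⊔ B) (t + 1), Ideal.sup_mul]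
      refine sup_le ?_ le_sup_right
      rw [ih, Ideal.mul_sup, ← pow_succ', ← ih]
      refine sup_le le_sup_left (le_sup_of_le_right ?_)
      rw [mul_left_comm, pow_succ' (A ⊔ B) t]
      exact Ideal.mul_mono_right (Ideal.mul_mono_left le_sup_left)
    · refine sup_le (Ideal.pow_right_mono le_sup_left _) ?_
      rw [pow_succ' (A ⊔ B) (t + 1)]
      exact Ideal.mul_mono_left le_sup_right

theorem mul_mem_sup_span_singleton_mul_iff {A B C : Ideal R} {x z : R}
    (hA : ∀ g, z * g ∈ A → g ∈ A) (hB : B = Ideal.span {z * x} * C) (g : R) :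
    z * g ∈ A ⊔ B ↔ g ∈ A ⊔ Ideal.span {x} * C := by
  subst hB
  constructor
  · intro h
    obtain ⟨a, ha, b, hb, hab⟩ := Submodule.mem_sup.1 h
    obtain ⟨c, hc, rfl⟩ := Ideal.mem_span_singleton_mul.1 hb
    have : g = (g - x * c) + x * c := by ring
    rw [this]
    refine add_mem (Ideal.mem_sup_left (hA _ ?_))
      (Ideal.mem_sup_right (Ideal.mul_mem_mul (Ideal.mem_span_singleton_self x) hc))
    have : z * (g - x * c) = a := by rw [mul_sub, ← hab]; ring
    rwa [this]
  · intro h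
    obtain ⟨a, ha, b, hb, rfl⟩ := Submodule.mem_sup.1 h
    obtain ⟨c, hc, rfl⟩ := Ideal.mem_span_singleton_mul.1 hb
    rw [mul_add, ← mul_assoc]
    exact add_mem (Ideal.mem_sup_left (A.mul_mem_left _ ha))
      (Ideal.mem_sup_right (Ideal.mul_mem_mul (Ideal.mem_span_singleton_self _) hc))

theorem mul_mem_pow_sup_iff {J₀ J₁ I : Ideal R} {x : R} (hJ₁ : J₁ ≤ Ideal.span {x})
    (hI : J₀ ⊔ J₁ ≤ I) {t : ℕ} (hx : ∀ g, x * g ∈ J₀ ^ (t + 1) → g ∈ J₀ ^ (t + 1)) (g : R) :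
    x * g ∈ (J₀ ⊔ J₁) ^ (t + 1) ⊔ Ideal.span {x} * I ^ t ↔ g ∈ I ^ t := by
  refine ⟨fun h ↦ ?_, fun h ↦ Ideal.mem_sup_right
    (Ideal.mul_mem_mul (Ideal.mem_span_singleton_self x) h)⟩
  have hle : (J₀ ⊔ J₁) ^ (t + 1) ⊔ Ideal.span {x} * I ^ t ≤
      J₀ ^ (t + 1) ⊔ Ideal.span {x} * I ^ t := by
    refine sup_le ?_ le_sup_right
    rw [Ideal.sup_pow_succ]
    exact sup_le le_sup_left (le_sup_of_le_right
      (Ideal.mul_mono hJ₁ (Ideal.pow_right_mono hI t)))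
  obtain ⟨a, ha, b, hb, hab⟩ := Submodule.mem_sup.1 (hle h)
  obtain ⟨c, hc, rfl⟩ := Ideal.mem_span_singleton_mul.1 hb
  have hgc : g - c ∈ J₀ ^ (t + 1) := hx _ (by rwa [mul_sub, ← hab, add_sub_cancel_right])
  have hJ : J₀ ^ (t + 1) ≤ I ^ t :=
    (Ideal.pow_right_mono (le_sup_left.trans hI) _).trans (Ideal.pow_le_pow_right t.le_succ)
  simpa using add_mem (hJ hgc) hc

theorem pow_succ_sup_span {J : Ideal R} {x z : R} (t : ℕ) :
    (J ⊔ Ideal.span {z * x}) ^ (t + 1) ⊔ Ideal.span {z} = J ^ (t + 1) ⊔ Ideal.span {z} := by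
  rw [Ideal.sup_pow_succ, sup_assoc]
  congr 1
  refine sup_eq_right.2 (Ideal.mul_le_left.trans ?_)
  rw [Ideal.span_singleton_le_span_singleton]
  exact dvd_mul_right z x

theorem hasProjectiveDimensionLT_quotient_pow_succ {J₀ J₁ J I : Ideal R} {x z : R}
    (hJ : J = J₀ ⊔ J₁) (hJ₁ : J₁ ≤ Ideal.span {x}) (hI : I = J ⊔ Ideal.span {z * x}) {t n : ℕ}
    (hx : ∀ g, x * g ∈ J₀ ^ (t + 1) → g ∈ J₀ ^ (t + 1))
    (hz : ∀ g, z * g ∈ J ^ (t + 1) → g ∈ J ^ (t + 1))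
    (h : HasProjectiveDimensionLT (ModuleCat.of R (R ⧸ I ^ t)) (n + 1))
    (h₀ : HasProjectiveDimensionLT (ModuleCat.of R (R ⧸ J₀ ^ (t + 1))) n)
    (h₁ : HasProjectiveDimensionLT (ModuleCat.of R (R ⧸ J ^ (t + 1))) n) :
    HasProjectiveDimensionLT (ModuleCat.of R (R ⧸ I ^ (t + 1))) (n + 1) := by
  have hI' : I ^ (t + 1) = J ^ (t + 1) ⊔ Ideal.span {z * x} * I ^ t := by
    rw [hI, Ideal.sup_pow_succ]
  refine hasProjectiveDimensionLT_quotient_of_colon (x := z)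
    (K := J ^ (t + 1) ⊔ Ideal.span {x} * I ^ t) (fun g ↦ ?_) ?_ ?_
  · rw [hI']
    exact mul_mem_sup_span_singleton_mul_iff hz rfl g
  · refine hasProjectiveDimensionLT_quotient_of_colon (x := x) (K := I ^ t) (fun g ↦ ?_) h ?_
    · rw [hJ]
      exact mul_mem_pow_sup_iff hJ₁ (by rw [← hJ, hI]; exact le_sup_left) hx g
    · have : J ^ (t + 1) ⊔ Ideal.span {x} * I ^ t ⊔ Ideal.span {x} =
          J₀ ^ (t + 1) ⊔ Ideal.span {x} := by
        rw [sup_assoc, sup_eq_right.2 (Ideal.mul_le_left (J := I ^ t)), hJ, Ideal.sup_pow_succ,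
          sup_assoc, sup_eq_right.2 (Ideal.mul_le_left.trans hJ₁)]
      rw [this]
      exact hasProjectiveDimensionLT_quotient_sup_span hx h₀
  · rw [hI, pow_succ_sup_span]
    exact hasProjectiveDimensionLT_quotient_sup_span hz h₁

theorem mem_pow_of_mul_mem_pow_succ {J₀ J₁ J I : Ideal R} {x z : R}
    (hJ : J = J₀ ⊔ J₁) (hJ₁ : J₁ ≤ Ideal.span {x}) (hI : I = J ⊔ Ideal.span {z * x}) {t : ℕ}
    (hx : ∀ g, x * g ∈ J₀ ^ (t + 1) → g ∈ J₀ ^ (t + 1))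
    (hz : ∀ g, z * g ∈ J ^ (t + 1) → g ∈ J ^ (t + 1)) {g : R} (hg : z * x * g ∈ I ^ (t + 1)) :
    g ∈ I ^ t := by
  have hI' : I ^ (t + 1) = J ^ (t + 1) ⊔ Ideal.span {z * x} * I ^ t := by
    rw [hI, Ideal.sup_pow_succ]
  rw [hI', mul_assoc, mul_mem_sup_span_singleton_mul_iff hz rfl, hJ,
    mul_mem_pow_sup_iff hJ₁ (by rw [← hJ, hI]; exact le_sup_left) hx] at hg
  exact hg

end Ideals

section MonomialIdeals

variable {k : Type*} [Field k] {V : Type*}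

/-- `K` is generated by monomials not involving the variable `y`. -/
def IsMonomialFree (y : V) (K : Ideal (MvPolynomial V k)) : Prop :=
  ∃ s : Set (V →₀ ℕ), (∀ a ∈ s, a y = 0) ∧ K = Ideal.span ((fun a ↦ monomial a (1 : k)) '' s)

theorem IsMonomialFree.mul {y : V} {K L : Ideal (MvPolynomial V k)} (hK : IsMonomialFree y K)
    (hL : IsMonomialFree y L) : IsMonomialFree y (K * L) := by
  obtain ⟨s, hs, rfl⟩ := hK
  obtain ⟨t, ht, rfl⟩ := hL
  refine ⟨Set.image2 (· + ·) s t, ?_, ?_⟩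
  · rintro _ ⟨a, ha, b, hb, rfl⟩
    simp [hs a ha, ht b hb]
  · rw [Ideal.span_mul_span']
    congr 1
    ext f
    simp only [Set.mem_mul, Set.mem_image, Set.mem_image2]
    constructor
    · rintro ⟨_, ⟨a, ha, rfl⟩, _, ⟨b, hb, rfl⟩, rfl⟩
      exact ⟨a + b, ⟨a, ha, b, hb, rfl⟩, by simp [monomial_mul]⟩
    · rintro ⟨_, ⟨a, ha, b, hb, rfl⟩, rfl⟩
      exact ⟨_, ⟨a, ha, rfl⟩, _, ⟨b, hb, rfl⟩, by simp [monomial_mul]⟩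

theorem IsMonomialFree.pow {y : V} {K : Ideal (MvPolynomial V k)} (hK : IsMonomialFree y K)
    (t : ℕ) : IsMonomialFree y (K ^ t) := by
  induction t with
  | zero => exact ⟨{0}, by simp, by simp [Ideal.one_eq_top]⟩
  | succ t ih => rw [pow_succ]; exact ih.mul hK

theorem IsMonomialFree.mem_of_X_pow_mul_mem {y : V} {K : Ideal (MvPolynomial V k)}
    (hK : IsMonomialFree y K) (j : ℕ) {g : MvPolynomial V k} (hg : X y ^ j * g ∈ K) : g ∈ K := by
  obtain ⟨s, hs, rfl⟩ := hK
  rw [mem_ideal_span_monomial_image] at hg ⊢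
  intro m hm
  obtain ⟨a, ha, hle⟩ := hg (Finsupp.single y j + m) (by
    rw [X_pow_eq_monomial, mem_support_iff, coeff_monomial_mul]
    simpa using hm)
  refine ⟨a, ha, fun v ↦ ?_⟩
  by_cases hv : v = y
  · simp [hv, hs a ha]
  · simpa [Finsupp.single_apply, Ne.symm hv] using hle v

theorem isMonomialFree_span_X {y : V} {A : Set V} (hA : y ∉ A) :
    IsMonomialFree y (Ideal.span (X '' A) : Ideal (MvPolynomial V k)) := by
  refine ⟨(fun v ↦ Finsupp.single v 1) '' A, ?_, ?_⟩
  · rintro _ ⟨v, hv, rfl⟩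
    exact Finsupp.single_eq_of_ne (by rintro rfl; exact hA hv)
  · rw [Set.image_image]; rfl

theorem isWeaklyRegular_map_X {l : List V} (hl : l.Nodup) :
    RingTheory.Sequence.IsWeaklyRegular (MvPolynomial V k)
      (l.map (X : V → MvPolynomial V k)) := by
  rw [RingTheory.Sequence.isWeaklyRegular_iff]
  intro i hi
  rw [isSMulRegular_quotient_iff_mem_of_smul_mem]
  intro g hg
  have hi' : i < l.length := by simpa using hi
  have hfree : IsMonomialFree l[i]
      (Ideal.span (X '' {v | v ∈ l.take i}) : Ideal (MvPolynomial V k)) :=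
    isMonomialFree_span_X (by
      rw [Set.mem_ofPred_eq, List.mem_take_iff_getElem]
      rintro ⟨j, hj, h⟩
      have := (hl.getElem_inj_iff).1 h
      lia)
  have heq : (Ideal.ofList ((l.map (X : V → MvPolynomial V k)).take i) • ⊤ :
      Ideal (MvPolynomial V k)) =
      Ideal.span (X '' {v | v ∈ l.take i}) := by
    rw [smul_eq_mul, Ideal.mul_top, ← List.map_take, Ideal.ofList]
    congr 1
    ext f
    simp only [Set.mem_ofPred_eq, List.mem_map, Set.mem_image]
  rw [heq] at hg ⊢
  refine hfree.mem_of_X_pow_mul_mem 1 ?_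
  simpa using hg

end MonomialIdeals

section Forest

variable {V : Type*} [DecidableEq V]

/-- In a rooted forest, every nonempty set of edges contains an edge whose head is a leaf. -/
theorem exists_edge_forall_ne {E : Finset (V × V)}
    (hloop : ∀ e ∈ E, e.1 ≠ e.2) (hrev : ∀ e ∈ E, (e.2, e.1) ∉ E)
    (hforest : (SimpleGraph.fromRel (fun u v : V ↦ (u, v) ∈ E)).IsAcyclic)
    (hindeg : ∀ v : V, (E.filter (fun e ↦ e.2 = v)).card ≤ 1)
    {F : Finset (V × V)} (hFE : F ⊆ E) (hF : F.Nonempty) :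
    ∃ e ∈ F, ∀ f ∈ F, f.1 ≠ e.2 := by
  by_contra! hcon
  choose! next hnext hnext' using hcon
  have hhead : ∀ e ∈ F, ∀ f ∈ F, e.2 = f.2 → e = f := fun e he f hf h ↦
    Finset.card_le_one.1 (hindeg f.2) e (by simp [hFE he, h]) f (by simp [hFE hf])
  have hmaps : Set.MapsTo next F F := fun e he ↦ hnext e he
  have hinj : Set.InjOn next F := fun e he f hf h ↦
    hhead e he f hf (by rw [← hnext' e he, ← hnext' f hf, h])
  obtain ⟨e, he⟩ := hF
  have hiter : ∀ n, next^[n] e ∈ F := fun n ↦ hmaps.iterate n he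
  have hper : ∃ p, 0 < p ∧ next^[p] e = e := by
    obtain ⟨i, j, hij, h⟩ : ∃ i j, i < j ∧ next^[i] e = next^[j] e := by
      by_contra! hne
      have hinj' : Function.Injective fun n ↦ (⟨next^[n] e, hiter n⟩ : F) := by
        intro i j h
        rcases lt_trichotomy i j with hlt | rfl | hlt
        · exact (hne i j hlt (congrArg Subtype.val h)).elim
        · rfl
        · exact (hne j i hlt (congrArg Subtype.val h).symm).elim
      exact not_injective_infinite_finite _ hinj'
    refine ⟨j - i, by lia, (hinj.iterate hmaps i) (hiter _) he ?_⟩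
    rw [← Function.iterate_add_apply, h]
    congr 1
    lia
  classical
  let p := Nat.find hper
  have hp : 0 < p ∧ next^[p] e = e := Nat.find_spec hper
  have hmin : ∀ q, 0 < q → q < p → next^[q] e ≠ e := fun q hq hqp h ↦
    Nat.find_min hper hqp ⟨hq, h⟩
  have hbridge := SimpleGraph.isAcyclic_iff_forall_adj_isBridge.1 hforest
    (v := e.1) (w := e.2) (by simp [hloop e (hFE he), hFE he])
  rw [SimpleGraph.isBridge_iff] at hbridge
  refine hbridge ?_
  symm
  have hreach : ∀ q, q + 1 ≤ p → ((SimpleGraph.fromRel (fun u v : V ↦ (u, v) ∈ E)).deleteEdges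
      {s(e.1, e.2)}).Reachable e.2 (next^[q + 1] e).1 := by
    intro q
    induction q with
    | zero => intro _; simp [hnext' e he]
    | succ q ih =>
      intro hq
      refine (ih (by lia)).trans ?_
      have hf := hiter (q + 1)
      rw [Function.iterate_succ_apply' next (q + 1), hnext' _ hf]
      have hne := hmin (q + 1) (by lia) (by lia)
      generalize next^[q + 1] e = f at *
      refine SimpleGraph.Adj.reachable ?_
      simp only [SimpleGraph.deleteEdges_adj, SimpleGraph.fromRel_adj, Set.mem_singleton_iff,
        Sym2.eq_iff, not_or, not_and]
      refine ⟨⟨hloop f (hFE hf), Or.inl (hFE hf)⟩, fun h1 h2 ↦ hne (Prod.ext h1 h2),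
        fun h1 h2 ↦ hrev e (hFE he) ?_⟩
      rw [← h1, ← h2]
      exact hFE hf
  have := hreach (p - 1) (by lia)
  rwa [Nat.sub_add_cancel hp.1, hp.2] at this

end Forest

section EdgeIdeals

variable {k : Type*} [Field k] {V : Type*} {w : V → ℕ}

theorem edgeIdeal_union [DecidableEq V] (E F : Finset (V × V)) :
    edgeIdeal k (E ∪ F) w = edgeIdeal k E w ⊔ edgeIdeal k F w := by
  simp only [edgeIdeal, Finset.coe_union, Set.image_union, Ideal.span_union]

theorem edgeIdeal_eq_span_monomial (E : Finset (V × V)) :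
    edgeIdeal k E w = Ideal.span ((fun a ↦ monomial a (1 : k)) ''
      ((fun e : V × V ↦ Finsupp.single e.1 1 + Finsupp.single e.2 (w e.2)) '' E)) := by
  rw [edgeIdeal, Set.image_image]
  congr 2
  ext e : 1
  rw [X_pow_eq_monomial, X, monomial_mul, one_mul]

theorem isMonomialFree_edgeIdeal {E : Finset (V × V)} {y : V}
    (h : ∀ f ∈ E, f.1 ≠ y ∧ f.2 ≠ y) : IsMonomialFree y (edgeIdeal k E w) := by
  refine ⟨_, ?_, edgeIdeal_eq_span_monomial E⟩
  rintro _ ⟨f, hf, rfl⟩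
  simp [Finsupp.single_eq_of_ne' (h f hf).1, Finsupp.single_eq_of_ne' (h f hf).2]

variable [DecidableEq V]

/-- `e` is an edge of `E` whose head lies on no other edge of `E`. -/
def IsLeafEdge (E : Finset (V × V)) (e : V × V) : Prop :=
  e ∈ E ∧ ∀ f ∈ E.erase e, f.1 ≠ e.2 ∧ f.2 ≠ e.2

variable {E : Finset (V × V)} {e : V × V}

/-- The edges avoiding both endpoints of `e`. -/
def avoidingEdges (E : Finset (V × V)) (e : V × V) : Finset (V × V) :=
  (E.erase e).filter fun f ↦ f.1 ≠ e.1 ∧ f.2 ≠ e.1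

theorem edgeIdeal_erase (E : Finset (V × V)) (e : V × V) :
    edgeIdeal k (E.erase e) w = edgeIdeal k (avoidingEdges E e) w ⊔
      edgeIdeal k ((E.erase e).filter fun f ↦ ¬ (f.1 ≠ e.1 ∧ f.2 ≠ e.1)) w := by
  rw [← edgeIdeal_union, avoidingEdges, Finset.filter_union_filter_not_eq]

theorem edgeIdeal_filter_le (hw : ∀ v, 1 ≤ w v) (E : Finset (V × V)) (e : V × V) :
    edgeIdeal k ((E.erase e).filter fun f ↦ ¬ (f.1 ≠ e.1 ∧ f.2 ≠ e.1)) w ≤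
      Ideal.span {X e.1} := by
  refine Ideal.span_le.2 ?_
  rintro _ ⟨f, hf, rfl⟩
  rw [SetLike.mem_coe, Ideal.mem_span_singleton]
  have hf' := (Finset.mem_filter.1 hf).2
  by_cases h1 : f.1 = e.1
  · exact ⟨X f.2 ^ w f.2, by simp [h1]⟩
  · have h2 : f.2 = e.1 := by tauto
    refine dvd_mul_of_dvd_right (dvd_pow (by rw [h2]) ?_) _
    have := hw f.2
    lia

theorem IsLeafEdge.edgeIdeal_eq (he : IsLeafEdge E e) :
    edgeIdeal k E w = edgeIdeal k (E.erase e) w ⊔ Ideal.span {X e.2 ^ w e.2 * X e.1} := by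
  conv_lhs => rw [← Finset.insert_erase he.1, ← Finset.union_singleton, edgeIdeal_union]
  simp [edgeIdeal, mul_comm]

theorem mem_of_X_mul_mem_avoidingEdges_pow (t : ℕ) (g : MvPolynomial V k)
    (hg : X e.1 * g ∈ edgeIdeal k (avoidingEdges E e) w ^ t) :
    g ∈ edgeIdeal k (avoidingEdges E e) w ^ t :=
  ((isMonomialFree_edgeIdeal fun _ hf ↦ (Finset.mem_filter.1 hf).2).pow t).mem_of_X_pow_mul_mem 1
    (by rwa [pow_one])

theorem IsLeafEdge.mem_of_X_pow_mul_mem_pow (he : IsLeafEdge E e) (j t : ℕ)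
    (g : MvPolynomial V k) (hg : X e.2 ^ j * g ∈ edgeIdeal k (E.erase e) w ^ t) :
    g ∈ edgeIdeal k (E.erase e) w ^ t :=
  ((isMonomialFree_edgeIdeal he.2).pow t).mem_of_X_pow_mul_mem j hg

theorem IsLeafEdge.mem_of_pow_mul_mem_pow (he : IsLeafEdge E e) (hw : ∀ v, 1 ≤ w v) {t : ℕ}
    {g : MvPolynomial V k}
    (hg : (X e.2 ^ w e.2 * X e.1) ^ t * g ∈ edgeIdeal k E w ^ (t + 1)) :
    g ∈ edgeIdeal k E w := by
  induction t with
  | zero => simpa using hg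
  | succ t ih =>
    rw [pow_succ' (X e.2 ^ w e.2 * X e.1), mul_assoc] at hg
    exact ih (mem_pow_of_mul_mem_pow_succ (edgeIdeal_erase E e) (edgeIdeal_filter_le hw E e)
      he.edgeIdeal_eq (mem_of_X_mul_mem_avoidingEdges_pow _)
      (he.mem_of_X_pow_mul_mem_pow _ _) hg)

end EdgeIdeals

section ProjectiveDimension

variable {k : Type u} [Field k] {V : Type u} [DecidableEq V] {w : V → ℕ}

theorem hasProjectiveDimensionLT_quotient_edgeIdeal_pow (hw : ∀ v, 1 ≤ w v)
    (E : Finset (V × V)) (hE : ∀ F ⊆ E, F.Nonempty → ∃ e, IsLeafEdge F e) (t : ℕ) :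
    HasProjectiveDimensionLT (ModuleCat.of (MvPolynomial V k)
      (MvPolynomial V k ⧸ edgeIdeal k E w ^ t)) (E.card + 1) := by
  induction E using Finset.strongInduction generalizing t with
  | H E ih =>
    induction t with
    | zero =>
      have : Subsingleton (MvPolynomial V k ⧸ edgeIdeal k E w ^ 0) :=
        Ideal.Quotient.subsingleton_iff.2 (by simp)
      have := (ModuleCat.isZero_of_subsingleton (ModuleCat.of (MvPolynomial V k)
        (MvPolynomial V k ⧸ edgeIdeal k E w ^ 0))).hasProjectiveDimensionLT_zero
      exact hasProjectiveDimensionLT_of_ge _ 0 _ (by lia)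
    | succ t iht =>
      rcases E.eq_empty_or_nonempty with rfl | hne
      · have h0 : edgeIdeal k (∅ : Finset (V × V)) w ^ (t + 1) = ⊥ := by
          have : edgeIdeal k (∅ : Finset (V × V)) w = ⊥ := by simp [edgeIdeal]
          rw [this, ← Ideal.zero_eq_bot, zero_pow t.succ_ne_zero]
        rw [h0, Finset.card_empty, zero_add, ← projective_iff_hasProjectiveDimensionLT_one,
          ← IsProjective.iff_projective]
        exact Module.Projective.of_equiv
          (Submodule.quotEquivOfEqBot (⊥ : Ideal (MvPolynomial V k)) rfl).symm
      · obtain ⟨e, he⟩ := hE E subset_rfl hne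
        have hss : E.erase e ⊂ E := Finset.erase_ssubset he.1
        have hss' : avoidingEdges E e ⊆ E.erase e := Finset.filter_subset _ _
        have hcard := Finset.card_erase_add_one he.1
        have hcard' := Finset.card_le_card hss'
        have h₀ := ih _ (hss'.trans_ssubset hss)
          (fun F hF ↦ hE F (hF.trans (hss'.trans hss.1))) (t + 1)
        have h₁ := ih _ hss (fun F hF ↦ hE F (hF.trans hss.1)) (t + 1)
        rw [hcard] at h₁
        exact hasProjectiveDimensionLT_quotient_pow_succ (edgeIdeal_erase E e)
          (edgeIdeal_filter_le hw E e) he.edgeIdeal_eq (mem_of_X_mul_mem_avoidingEdges_pow _)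
          (he.mem_of_X_pow_mul_mem_pow _ _) iht
          (hasProjectiveDimensionLT_of_ge _ ((avoidingEdges E e).card + 1) _ (by lia)) h₁

theorem le_of_hasProjectiveDimensionLT_quotient_edgeIdeal_pow [Fintype V] (hw : ∀ v, 1 ≤ w v)
    {E : Finset (V × V)} {e : V × V} (he : IsLeafEdge E e) (hloop : ∀ f ∈ E, f.1 ≠ f.2)
    (hhead : Set.InjOn Prod.snd (E : Set (V × V)))
    (hw2 : ∀ f ∈ E, ∀ f' ∈ E, f.2 = f'.1 → 2 ≤ w f.2) {t d : ℕ}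
    (hd : HasProjectiveDimensionLT (ModuleCat.of (MvPolynomial V k)
      (MvPolynomial V k ⧸ edgeIdeal k E w ^ (t + 1))) (d + 1)) :
    E.card ≤ d := by
  by_contra! hlt
  let H : Finset V := E.image Prod.snd
  let c : V →₀ ℕ := Finsupp.equivFunOnFinite.symm fun v ↦ if v ∈ H then w v - 1 else 1
  have hc : ∀ v, c v = if v ∈ H then w v - 1 else 1 := fun _ ↦ rfl
  have hreg := isWeaklyRegular_map_X (k := k) H.nodup_toList
  have hlen : d < (H.toList.map (X : V → MvPolynomial V k)).length := by
    rw [List.length_map, Finset.length_toList, Finset.card_image_of_injOn hhead]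
    exact hlt
  have hmem := mem_of_hasProjectiveDimensionLT_quotient hreg hlen hd
    (u := (X e.2 ^ w e.2 * X e.1) ^ t * monomial c 1) ?_
  · have hu := he.mem_of_pow_mul_mem_pow hw hmem
    rw [edgeIdeal_eq_span_monomial, mem_ideal_span_monomial_image] at hu
    obtain ⟨_, ⟨f, hf, rfl⟩, hle⟩ := hu c (by simp)
    have h1 := hle f.2
    have h2 : f.2 ∈ H := Finset.mem_image_of_mem _ hf
    have h3 := hw f.2
    rw [hc, if_pos h2] at h1
    simp at h1
    lia
  · intro r hr
    obtain ⟨v, hv, rfl⟩ := List.mem_map.1 hr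
    obtain ⟨f, hf, rfl⟩ := Finset.mem_image.1 (Finset.mem_toList.1 hv)
    rw [mul_left_comm, pow_succ]
    refine Ideal.mul_mem_mul (Ideal.pow_mem_pow ?_ t) ?_
    · rw [he.edgeIdeal_eq]
      exact Ideal.mem_sup_right (Ideal.mem_span_singleton_self _)
    · rw [edgeIdeal_eq_span_monomial, X, monomial_mul, one_mul, mem_ideal_span_monomial_image]
      intro m hm
      obtain rfl : m = Finsupp.single f.2 1 + c := by
        by_contra hne
        simp [coeff_monomial, Ne.symm hne] at hm
      refine ⟨_, ⟨f, hf, rfl⟩, fun v ↦ ?_⟩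
      have hfl := hloop f hf
      have h2 : f.2 ∈ H := Finset.mem_image_of_mem _ hf
      have h3 := hw f.2
      simp only [Finsupp.add_apply, hc]
      rcases eq_or_ne v f.2 with rfl | hv2
      · simp [Finsupp.single_eq_of_ne' hfl, h2]
        lia
      · rw [Finsupp.single_eq_of_ne hv2, Finsupp.single_eq_of_ne hv2]
        rcases eq_or_ne v f.1 with rfl | hv1
        · split_ifs with h
          · obtain ⟨g, hg, hgf⟩ := Finset.mem_image.1 h
            have := hw2 g hg f hf hgf
            rw [hgf] at this
            simp
            lia
          · simp
        · simp [Finsupp.single_eq_of_ne hv1]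

end ProjectiveDimension

theorem projDim_eq_of_hasProjDimLE_of_forall_le {R : Type u} [Ring R]
    {M : Type v} [AddCommGroup M] [Module R M]
    {n : ℕ} (h : HasProjDimLE R n M) (h' : ∀ m, HasProjDimLE R m M → n ≤ m) :
    projDim R M = n := by
  refine le_antisymm (sInf_le ⟨n, rfl, h⟩) (le_sInf ?_)
  rintro _ ⟨m, rfl, hm⟩
  exact_mod_cast h' m hm

/-- **Theorem (pd of powers of edge ideals of vertex-weighted rooted forests).**
Let `D = (V, E, w)` be a vertex-weighted rooted forest (the underlying graph is a
forest and every vertex has in-degree at most one, so all edges are oriented away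
from the roots) with `w(x) ≥ 2` whenever `d(x) ≠ 1`.  Then for all `t ≥ 1`,
`pd (I(D)^t) = |E(D)| - 1`. -/
theorem pd_pow_edgeIdeal_rootedForest
    (k : Type) [Field k] (V : Type) [Fintype V] [DecidableEq V]
    (E : Finset (V × V)) (w : V → ℕ)
    (hw : ∀ v : V, 1 ≤ w v)
    (hloop : ∀ e ∈ E, e.1 ≠ e.2)
    (hrev : ∀ e ∈ E, (e.2, e.1) ∉ E)
    (hforest : (SimpleGraph.fromRel (fun u v : V => (u, v) ∈ E)).IsAcyclic)
    (hindeg : ∀ v : V, (E.filter (fun e => e.2 = v)).card ≤ 1)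
    (hw2 : ∀ x : V, (E.filter (fun e => e.1 = x ∨ e.2 = x)).card ≠ 1 → 2 ≤ w x)
    (t : ℕ) (ht : 1 ≤ t) :
    projDim (MvPolynomial V k) ↥((edgeIdeal k E w) ^ t) = ((E.card - 1 : ℕ) : ℕ∞) := by
  obtain ⟨t, rfl⟩ := Nat.exists_eq_add_of_le' ht
  have hhead : Set.InjOn Prod.snd (E : Set (V × V)) := fun e he f hf h ↦
    Finset.card_le_one.1 (hindeg f.2) e (Finset.mem_filter.2 ⟨he, h⟩) f
      (Finset.mem_filter.2 ⟨hf, rfl⟩)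
  have hleaf : ∀ F ⊆ E, F.Nonempty → ∃ e, IsLeafEdge F e := by
    intro F hFE hF
    obtain ⟨e, he, h⟩ := exists_edge_forall_ne hloop hrev hforest hindeg hFE hF
    refine ⟨e, he, fun f hf ↦ ⟨h f (Finset.mem_of_mem_erase hf), fun h2 ↦ ?_⟩⟩
    exact Finset.ne_of_mem_erase hf (hhead (hFE (Finset.mem_of_mem_erase hf)) (hFE he) h2)
  have hw2' : ∀ f ∈ E, ∀ f' ∈ E, f.2 = f'.1 → 2 ≤ w f.2 := by
    refine fun f hf f' hf' h ↦ hw2 _ (ne_of_gt (Finset.one_lt_card.2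
      ⟨f, by simp [hf], f', by simp [hf', h], ?_⟩))
    rintro rfl
    exact hloop f hf h.symm
  refine projDim_eq_of_hasProjDimLE_of_forall_le ?_ fun m hm ↦ ?_
  · rw [hasProjDimLE_iff_hasProjectiveDimensionLT, ← hasProjectiveDimensionLT_quotient_iff]
    have := hasProjectiveDimensionLT_quotient_edgeIdeal_pow (k := k) hw E hleaf (t + 1)
    exact hasProjectiveDimensionLT_of_ge _ (E.card + 1) _ (by lia)
  · rcases E.eq_empty_or_nonempty with rfl | hne
    · simp
    · obtain ⟨e, he⟩ := hleaf E subset_rfl hne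
      rw [hasProjDimLE_iff_hasProjectiveDimensionLT, ← hasProjectiveDimensionLT_quotient_iff] at hm
      have := le_of_hasProjectiveDimensionLT_quotient_edgeIdeal_pow hw he hloop hhead hw2' hm
      lia
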